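/- Let μ and ν be probability measures on compact subsets X and Y of ℝ^d, and assume there exists a convex differentiable function f₀ : ℝ^d → ℝ with (∇f₀)_#μ = ν; set T₀ = ∇f₀. Let f : ℝ^d → ℝ be a C¹, γ-strongly convex function whose gradient is M-Lipschitz (0 < γ ≤ M). Then J_{μ,ν}(f) − J_{μ,ν}(f₀) ≤ (1/(2γ)) ∫ ‖∇f(x) − T₀(x)‖² dμ(x). -/

import Mathlib

open MeasureTheory
open scoped RealInnerProductSpace

noncomputable def conj {d : ℕ} (f : EuclideanSpace ℝ (Fin d) → ℝ)
    (y : EuclideanSpace ℝ (Fin d)) : EReal :=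
  ⨆ x : EuclideanSpace ℝ (Fin d), ((⟪x, y⟫ - f x : ℝ) : EReal)

open Classical in
/-- Integral of an `EReal`-valued function, valued in `(-∞, +∞]`:
it is the Bochner integral when the function is a.e. finite and integrable, `+∞` otherwise. -/
noncomputable def eintegral {d : ℕ} (ν : Measure (EuclideanSpace ℝ (Fin d)))
    (g : EuclideanSpace ℝ (Fin d) → EReal) : EReal :=
  if (∀ᵐ y ∂ν, g y ≠ ⊤) ∧ Integrable (fun y => (g y).toReal) ν
  then ((∫ y, (g y).toReal ∂ν : ℝ) : EReal) else ⊤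

/-- The semi-dual Brenier objective `J_{μ,ν}(f) = ∫ f dμ + ∫ f* dν`. -/
noncomputable def Jsd {d : ℕ} (μ ν : Measure (EuclideanSpace ℝ (Fin d)))
    (f : EuclideanSpace ℝ (Fin d) → ℝ) : EReal :=
  ((∫ x, f x ∂μ : ℝ) : EReal) + eintegral ν (conj f)

theorem grad_ineq_aux {d : ℕ} (g : EuclideanSpace ℝ (Fin d) → ℝ)
    (hg : ConvexOn ℝ Set.univ g) (v x : EuclideanSpace ℝ (Fin d))
    (h : HasGradientAt g v x) (z : EuclideanSpace ℝ (Fin d)) :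
    g x + ⟪v, z - x⟫ ≤ g z := by
  have hl : HasDerivAt (fun t : ℝ => AffineMap.lineMap x z t) (z - x) 0 :=
    AffineMap.hasDerivAt_lineMap
  have hc : ConvexOn ℝ Set.univ (fun t : ℝ => g (AffineMap.lineMap x z t)) := by
    have := hg.comp_affineMap (AffineMap.lineMap (k := ℝ) x z)
    simpa [Function.comp_def] using this
  have h' : HasFDerivAt g (InnerProductSpace.toDual ℝ _ v) (AffineMap.lineMap x z (0 : ℝ)) := by
    simpa using h.hasFDerivAt
  have hd := h'.comp_hasDerivAt (0 : ℝ) hl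
  have := hc.le_slope_of_hasDerivAt (Set.mem_univ 0) (Set.mem_univ 1) zero_lt_one hd
  simp [slope_def_field] at this
  linarith

theorem conj_measurable_aux {d : ℕ} (f : EuclideanSpace ℝ (Fin d) → ℝ) :
    Measurable (conj f) := by
  apply LowerSemicontinuous.measurable
  apply lowerSemicontinuous_iSup
  intro x
  apply Continuous.lowerSemicontinuous
  exact continuous_coe_real_ereal.comp (by fun_prop)

theorem conj_ge_aux {d : ℕ} (f : EuclideanSpace ℝ (Fin d) → ℝ)
    (x y : EuclideanSpace ℝ (Fin d)) : ((⟪x, y⟫ - f x : ℝ) : EReal) ≤ conj f y :=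
  le_iSup (fun x : EuclideanSpace ℝ (Fin d) => ((⟪x, y⟫ - f x : ℝ) : EReal)) x

theorem conj_toReal_ge_aux {d : ℕ} (f : EuclideanSpace ℝ (Fin d) → ℝ)
    (x y : EuclideanSpace ℝ (Fin d)) (h : conj f y ≠ ⊤) :
    ⟪x, y⟫ - f x ≤ (conj f y).toReal := by
  have := EReal.toReal_le_toReal (conj_ge_aux f x y) (EReal.coe_ne_bot _) h
  rwa [EReal.toReal_coe] at this

theorem conj_le_aux {d : ℕ} (γ : ℝ) (hγ : 0 < γ) (f : EuclideanSpace ℝ (Fin d) → ℝ)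
    (Tf : EuclideanSpace ℝ (Fin d) → EuclideanSpace ℝ (Fin d))
    (hsc : ConvexOn ℝ Set.univ (fun x => f x - γ / 2 * ‖x‖ ^ 2))
    (hgradf : ∀ x, HasGradientAt f (Tf x) x) (x y : EuclideanSpace ℝ (Fin d)) :
    conj f y ≤ ((⟪x, y⟫ - f x + 1 / (2 * γ) * ‖Tf x - y‖ ^ 2 : ℝ) : EReal) := by
  apply iSup_le
  intro z
  rw [EReal.coe_le_coe_iff]
  have hgr : HasGradientAt (fun x => f x - γ / 2 * ‖x‖ ^ 2) (Tf x - γ • x) x := by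
    rw [hasGradientAt_iff_hasFDerivAt]
    have h1 := (hgradf x).hasFDerivAt
    have h2 := ((hasStrictFDerivAt_norm_sq x).hasFDerivAt).const_mul (γ / 2)
    refine (h1.sub h2).congr_fderiv ?_
    ext w
    simp [inner_sub_left, inner_smul_left]
    ring
  have h := grad_ineq_aux _ hsc _ x hgr z
  have hsq : 0 ≤ ‖γ • (z - x) + (Tf x - y)‖ ^ 2 := by positivity
  rw [norm_add_sq_real, norm_smul, mul_pow, inner_smul_left] at hsq
  have e1 : ‖z‖ ^ 2 = ‖x‖ ^ 2 + 2 * ⟪x, z - x⟫ + ‖z - x‖ ^ 2 := by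
    rw [← norm_add_sq_real]; simp
  have e2 : ⟪z, y⟫ = ⟪x, y⟫ + ⟪z - x, y⟫ := by rw [← inner_add_left]; simp
  have e3 : ⟪z - x, Tf x - y⟫ = ⟪Tf x, z - x⟫ - ⟪z - x, y⟫ := by
    rw [inner_sub_right, real_inner_comm]
  simp only [inner_sub_left (Tf x), inner_smul_left] at h
  simp only [e3, e1] at h hsq
  simp at h hsq
  rw [e2]
  have key : 0 ≤ γ / 2 * ‖z - x‖ ^ 2 + (⟪Tf x, z - x⟫ - ⟪z - x, y⟫)
      + 1 / (2 * γ) * ‖Tf x - y‖ ^ 2 := by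
    have : γ / 2 * ‖z - x‖ ^ 2 + (⟪Tf x, z - x⟫ - ⟪z - x, y⟫)
      + 1 / (2 * γ) * ‖Tf x - y‖ ^ 2 = 1 / (2 * γ) * (γ ^ 2 * ‖z - x‖ ^ 2
        + 2 * (γ * (⟪Tf x, z - x⟫ - ⟪z - x, y⟫)) + ‖Tf x - y‖ ^ 2) := by
      field_simp
    rw [this]
    exact mul_nonneg (by positivity) hsq
  linarith

theorem integrable_aux {d : ℕ} {X : Set (EuclideanSpace ℝ (Fin d))} (hX : IsCompact X)
    (μ : Measure (EuclideanSpace ℝ (Fin d))) [IsProbabilityMeasure μ] (hμX : ∀ᵐ x ∂μ, x ∈ X)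
    (f : EuclideanSpace ℝ (Fin d) → ℝ) (hf : Continuous f) : Integrable f μ := by
  obtain ⟨C, hC⟩ := hX.exists_bound_of_continuousOn hf.continuousOn
  exact Integrable.of_bound hf.aestronglyMeasurable C (hμX.mono hC)

/-- upper bound `J(f) - J(f₀) ≤ (1/(2γ)) ∫ ‖∇f - T₀‖² dμ`. -/
theorem stmt_4 {d : ℕ} (X Y : Set (EuclideanSpace ℝ (Fin d)))
    (hX : IsCompact X) (hY : IsCompact Y)
    (μ ν : Measure (EuclideanSpace ℝ (Fin d)))
    [IsProbabilityMeasure μ] [IsProbabilityMeasure ν]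
    (hμX : μ Xᶜ = 0) (hνY : ν Yᶜ = 0)
    (f₀ : EuclideanSpace ℝ (Fin d) → ℝ)
    (T₀ : EuclideanSpace ℝ (Fin d) → EuclideanSpace ℝ (Fin d))
    (hconv : ConvexOn ℝ Set.univ f₀)
    (hgrad₀ : ∀ x, HasGradientAt f₀ (T₀ x) x)
    (hpush : Measure.map T₀ μ = ν)
    (γ M : ℝ) (hγ : 0 < γ) (hγM : γ ≤ M)
    (f : EuclideanSpace ℝ (Fin d) → ℝ)
    (Tf : EuclideanSpace ℝ (Fin d) → EuclideanSpace ℝ (Fin d))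
    (hC1 : ContDiff ℝ 1 f)
    (hsc : ConvexOn ℝ Set.univ (fun x => f x - γ / 2 * ‖x‖ ^ 2))
    (hgradf : ∀ x, HasGradientAt f (Tf x) x)
    (hlip : ∀ a b, ‖Tf a - Tf b‖ ≤ M * ‖a - b‖) :
    Jsd μ ν f - Jsd μ ν f₀ ≤ ((1 / (2 * γ) * ∫ x, ‖Tf x - T₀ x‖ ^ 2 ∂μ : ℝ) : EReal) := by
  have hX' : ∀ᵐ x ∂μ, x ∈ X := hμX
  have hY' : ∀ᵐ y ∂ν, y ∈ Y := hνY
  have hT : AEMeasurable T₀ μ := by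
    by_contra h
    rw [Measure.map_of_not_aemeasurable h] at hpush
    exact IsProbabilityMeasure.ne_zero ν hpush.symm
  have hTY : ∀ᵐ x ∂μ, T₀ x ∈ Y := by
    rw [← hpush] at hY'
    exact ae_of_ae_map hT hY'
  by_cases h0 : (∀ᵐ y ∂ν, conj f₀ y ≠ ⊤) ∧ Integrable (fun y => (conj f₀ y).toReal) ν
  swap
  · have : Jsd μ ν f₀ = ⊤ := by
      unfold Jsd eintegral
      rw [if_neg h0]
      exact EReal.coe_add_top _
    rw [this, EReal.sub_top]
    exact bot_le
  have hcf := conj_le_aux γ hγ f Tf hsc hgradf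
  have hft : ∀ y, conj f y ≠ ⊤ := fun y h => by
    have := hcf 0 y
    rw [h, top_le_iff] at this
    exact EReal.coe_ne_top _ this
  have hup : ∀ x y, (conj f y).toReal ≤ ⟪x, y⟫ - f x + 1 / (2 * γ) * ‖Tf x - y‖ ^ 2 := by
    intro x y
    have hb : conj f y ≠ ⊥ := fun h => by
      have := conj_ge_aux f 0 y
      rw [h, le_bot_iff] at this
      exact EReal.coe_ne_bot _ this
    have := EReal.toReal_le_toReal (hcf x y) hb (EReal.coe_ne_top _)
    rwa [EReal.toReal_coe] at this
  have hTfc : Continuous Tf := by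
    have : LipschitzWith M.toNNReal Tf := LipschitzWith.of_dist_le_mul fun a b => by
      rw [dist_eq_norm, dist_eq_norm, Real.coe_toNNReal _ (hγ.le.trans hγM)]
      exact hlip a b
    exact this.continuous
  have hif : Integrable (fun y => (conj f y).toReal) ν := by
    obtain ⟨C, hC⟩ := hY.exists_bound_of_continuousOn
      (f := fun y => - f 0 + 1 / (2 * γ) * ‖Tf 0 - y‖ ^ 2) (by fun_prop)
    refine Integrable.of_bound
      (conj_measurable_aux f).ereal_toReal.aestronglyMeasurable (|f 0| + C) ?_
    filter_upwards [hY'] with y hy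
    have h1 := hup 0 y
    have h2 := conj_toReal_ge_aux f 0 y (hft y)
    have h3 := hC y hy
    simp only [Real.norm_eq_abs] at h3 ⊢
    rw [inner_zero_left] at h1 h2
    have h4 := abs_le.1 h3
    have h5 := neg_abs_le (f 0)
    have h6 := le_abs_self (f 0)
    have h7 : 0 ≤ C := (abs_nonneg _).trans h3
    rw [abs_le]
    constructor <;> linarith
  have hJf : Jsd μ ν f = ((∫ x, f x ∂μ + ∫ y, (conj f y).toReal ∂ν : ℝ) : EReal) := by
    unfold Jsd eintegral
    rw [if_pos ⟨Filter.Eventually.of_forall hft, hif⟩, EReal.coe_add]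
  have hJf₀ : Jsd μ ν f₀ = ((∫ x, f₀ x ∂μ + ∫ y, (conj f₀ y).toReal ∂ν : ℝ) : EReal) := by
    unfold Jsd eintegral
    rw [if_pos h0, EReal.coe_add]
  rw [hJf, hJf₀, ← EReal.coe_sub, EReal.coe_le_coe_iff]
  obtain ⟨h0t, h0i⟩ := h0
  have hf₀c : Continuous f₀ :=
    continuous_iff_continuousAt.2 fun x => (hgrad₀ x).hasFDerivAt.continuousAt
  have If : Integrable f μ := integrable_aux hX μ hX' f hC1.continuous
  have If₀ : Integrable f₀ μ := integrable_aux hX μ hX' f₀ hf₀c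
  obtain ⟨CX, hCX⟩ := hX.exists_bound_of_continuousOn (f := fun x => x) continuousOn_id
  obtain ⟨CY, hCY⟩ := hY.exists_bound_of_continuousOn (f := fun x => x) continuousOn_id
  obtain ⟨CT, hCT⟩ := hX.exists_bound_of_continuousOn hTfc.continuousOn
  have Iin : Integrable (fun x => ⟪x, T₀ x⟫) μ := by
    refine Integrable.of_bound (aestronglyMeasurable_id.inner hT.aestronglyMeasurable)
      (CX * CY) ?_
    filter_upwards [hX', hTY] with x h1 h2
    exact (norm_inner_le_norm _ _).trans (mul_le_mul (hCX x h1) (hCY _ h2) (norm_nonneg _)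
      ((norm_nonneg _).trans (hCX x h1)))
  have Isq : Integrable (fun x => ‖Tf x - T₀ x‖ ^ 2) μ := by
    refine Integrable.of_bound
      ((hTfc.aestronglyMeasurable.sub hT.aestronglyMeasurable).norm.pow 2) ((CT + CY) ^ 2) ?_
    filter_upwards [hX', hTY] with x h1 h2
    rw [Real.norm_of_nonneg (by positivity)]
    exact pow_le_pow_left₀ (norm_nonneg _)
      ((norm_sub_le _ _).trans (add_le_add (hCT x h1) (hCY _ h2))) 2
  subst hpush
  rw [integral_map hT hif.aestronglyMeasurable, integral_map hT h0i.aestronglyMeasurable]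
  have hif' := hif.comp_aemeasurable hT
  have h0i' := h0i.comp_aemeasurable hT
  have A : ∫ x, (⟪x, T₀ x⟫ - f₀ x) ∂μ ≤ ∫ x, (conj f₀ (T₀ x)).toReal ∂μ := by
    refine integral_mono_ae (Iin.sub If₀) h0i' ?_
    filter_upwards [ae_of_ae_map hT h0t] with x hx
    exact conj_toReal_ge_aux f₀ x _ hx
  have B : ∫ x, (conj f (T₀ x)).toReal ∂μ
      ≤ ∫ x, (⟪x, T₀ x⟫ - f x + 1 / (2 * γ) * ‖Tf x - T₀ x‖ ^ 2) ∂μ :=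
    integral_mono hif' ((Iin.sub If).add (Isq.const_mul _)) fun x => hup x (T₀ x)
  rw [integral_sub Iin If₀] at A
  have Isub : Integrable (fun x => ⟪x, T₀ x⟫ - f x) μ := Iin.sub If
  rw [integral_add Isub (Isq.const_mul _), integral_sub Iin If, integral_const_mul] at B
  linarith
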